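/- arXiv:1711.07016 — 2 statements merged into one kernel-verified Lean document; each statement's English description precedes it below -/
import Mathlib

section
/- Let α ∈ (0,1) and t > 0 be real, and let f(s) = ∑_{k=0}^∞ s^{αk} / (α^k (k!)^α) for s > 0 (real powers s^{αk} of the positive number s). Then (1/Γ(1−α)) ∫_0^t (ln(t/τ))^{−α} f′(τ) dτ = α^{α−1} t^α f(t); that is, the Le Roy-type function f(t) = E_{α;1,1}(t^α/α) satisfies the Caputo–Hadamard fractional equation t^{−α} (t d/dt)^α f = α^{α−1} f. -/
open Set MeasureTheory Filter Topology

lemma image_mul_exp_neg_Ioi {t : ℝ} (ht : 0 < t) :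
    (fun u : ℝ => t * Real.exp (-u)) '' Ioi 0 = Ioo 0 t := by
  ext x
  constructor
  · rintro ⟨u, hu, rfl⟩
    have hu : 0 < u := hu
    have : Real.exp (-u) < 1 := by simpa using hu
    exact ⟨by positivity, by nlinarith⟩
  · rintro ⟨h0, h1⟩
    refine ⟨Real.log (t / x), Real.log_pos ((one_lt_div h0).2 h1), ?_⟩
    simp only
    rw [Real.exp_neg, Real.exp_log (by positivity)]
    field_simp

lemma abs_deriv_smul_log_kernel {a b t u : ℝ} (ht : 0 < t) :
    |-(t * Real.exp (-u))| • (Real.log (t / (t * Real.exp (-u))) ^ (-a) *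
      (t * Real.exp (-u)) ^ (b - 1)) = t ^ b * (u ^ (-a) * Real.exp (-(b * u))) := by
  have hp : 0 < t * Real.exp (-u) := by positivity
  have hlog : Real.log (t / (t * Real.exp (-u))) = u := by
    rw [← div_div, div_self ht.ne', one_div, ← Real.exp_neg, neg_neg, Real.log_exp]
  rw [abs_neg, abs_of_pos hp, hlog, smul_eq_mul, Real.rpow_sub_one hp.ne',
    Real.mul_rpow ht.le (Real.exp_pos _).le, ← Real.exp_mul]
  field_simp

lemma hasDerivWithinAt_mul_exp_neg (t u : ℝ) (s : Set ℝ) :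
    HasDerivWithinAt (fun u : ℝ => t * Real.exp (-u)) (-(t * Real.exp (-u))) s u := by
  exact (((hasDerivAt_neg u).exp.const_mul t).congr_deriv (by ring)).hasDerivWithinAt

lemma injective_mul_exp_neg {t : ℝ} (ht : 0 < t) :
    Function.Injective (fun u : ℝ => t * Real.exp (-u)) := fun x y h => by
  simpa [ht.ne'] using h

lemma integrableOn_log_rpow_mul_rpow {a b t : ℝ} (ha : a < 1) (hb : 0 < b) (ht : 0 < t) :
    IntegrableOn (fun x : ℝ => Real.log (t / x) ^ (-a) * x ^ (b - 1)) (Ioc 0 t) := by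
  rw [integrableOn_Ioc_iff_integrableOn_Ioo, ← image_mul_exp_neg_Ioi ht,
    integrableOn_image_iff_integrableOn_abs_deriv_smul measurableSet_Ioi
      (fun u _ => hasDerivWithinAt_mul_exp_neg t u _) (injective_mul_exp_neg ht).injOn]
  simp only [abs_deriv_smul_log_kernel ht]
  have h := integrableOn_rpow_mul_exp_neg_mul_rpow (s := -a) (p := 1) (b := b)
    (by linarith) one_pos hb
  simp only [Real.rpow_one, neg_mul] at h
  exact h.const_mul _

lemma integral_log_rpow_mul_rpow {a b t : ℝ} (ha : a < 1) (hb : 0 < b) (ht : 0 < t) :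
    ∫ x in Ioc 0 t, Real.log (t / x) ^ (-a) * x ^ (b - 1) =
      t ^ b * (b ^ (a - 1) * Real.Gamma (1 - a)) := by
  rw [integral_Ioc_eq_integral_Ioo, ← image_mul_exp_neg_Ioi ht,
    integral_image_eq_integral_abs_deriv_smul measurableSet_Ioi
      (fun u _ => hasDerivWithinAt_mul_exp_neg t u _) (injective_mul_exp_neg ht).injOn]
  simp only [abs_deriv_smul_log_kernel ht]
  rw [integral_const_mul]
  have h := Real.integral_rpow_mul_exp_neg_mul_Ioi (a := 1 - a) (by linarith) hb
  rw [show 1 - a - 1 = -a by ring] at h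
  rw [h, one_div, Real.inv_rpow hb.le, ← Real.rpow_neg hb.le, neg_sub]

lemma summable_pow_div_factorial_rpow {a x : ℝ} (ha : 0 < a) (hx : 0 < x) :
    Summable fun k : ℕ => x ^ k / (k.factorial : ℝ) ^ a := by
  refine summable_of_ratio_test_tendsto_lt_one (l := 0) zero_lt_one
    (Eventually.of_forall fun k => by positivity) ?_
  have h : Tendsto (fun k : ℕ => x / ((k + 1 : ℕ) : ℝ) ^ a) atTop (𝓝 0) :=
    ((tendsto_rpow_atTop ha).comp
      (tendsto_natCast_atTop_atTop.comp (tendsto_add_atTop_nat 1))).const_div_atTop x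
  refine h.congr fun k => ?_
  rw [Real.norm_of_nonneg (by positivity), Real.norm_of_nonneg (by positivity),
    Nat.factorial_succ, Nat.cast_mul, Real.mul_rpow (by positivity) (by positivity), pow_succ]
  field_simp

lemma rpow_mul_natCast_div_eq {α s : ℝ} (hs : 0 ≤ s) (k : ℕ) :
    s ^ (α * (k : ℝ)) / (α ^ k * (Nat.factorial k : ℝ) ^ α) =
      (s ^ α / α) ^ k / (Nat.factorial k : ℝ) ^ α := by
  rw [Real.rpow_mul_natCast hs, div_pow, div_div]

lemma summable_leRoy {α s : ℝ} (hα : 0 < α) (hs : 0 < s) :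
    Summable fun k : ℕ => s ^ (α * (k : ℝ)) / (α ^ k * (Nat.factorial k : ℝ) ^ α) := by
  simp only [rpow_mul_natCast_div_eq hs.le]
  exact summable_pow_div_factorial_rpow hα (by positivity)

lemma summable_natCast_mul_leRoy {α s : ℝ} (hα : 0 < α) (hs : 0 < s) :
    Summable fun k : ℕ =>
      (k : ℝ) * (s ^ (α * (k : ℝ)) / (α ^ k * (Nat.factorial k : ℝ) ^ α)) := by
  refine Summable.of_nonneg_of_le (fun k => by positivity) (fun k => ?_)
    (summable_pow_div_factorial_rpow hα (x := 2 * (s ^ α / α)) (by positivity))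
  rw [rpow_mul_natCast_div_eq hs.le, mul_pow, mul_div_assoc]
  gcongr
  exact_mod_cast k.lt_two_pow_self.le

lemma hasDerivAt_leRoy {α τ : ℝ} (hα : 0 < α) (hτ : 0 < τ) :
    HasDerivAt (fun s : ℝ => ∑' k : ℕ, s ^ (α * (k : ℝ)) / (α ^ k * (Nat.factorial k : ℝ) ^ α))
      (∑' k : ℕ, α * k * τ ^ (α * (k : ℝ) - 1) / (α ^ k * (Nat.factorial k : ℝ) ^ α)) τ := by
  have hmem : τ ∈ Ioo (τ / 2) (2 * τ) := ⟨by linarith, by linarith⟩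
  have hbound (k : ℕ) (s : ℝ) (hs : s ∈ Ioo (τ / 2) (2 * τ)) :
      ‖α * k * s ^ (α * (k : ℝ) - 1) / (α ^ k * (Nat.factorial k : ℝ) ^ α)‖ ≤
        α * (τ / 2)⁻¹ *
          (k * ((2 * τ) ^ (α * (k : ℝ)) / (α ^ k * (Nat.factorial k : ℝ) ^ α))) := by
    have hs0 : 0 < s := by linarith [hs.1]
    rw [Real.norm_of_nonneg (by positivity), Real.rpow_sub_one hs0.ne']
    have hpow : s ^ (α * (k : ℝ)) ≤ (2 * τ) ^ (α * (k : ℝ)) :=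
      Real.rpow_le_rpow hs0.le hs.2.le (by positivity)
    have hinv : s⁻¹ ≤ (τ / 2)⁻¹ := inv_anti₀ (by positivity) hs.1.le
    calc α * k * (s ^ (α * (k : ℝ)) / s) / (α ^ k * (Nat.factorial k : ℝ) ^ α)
        = α * s⁻¹ * (k * (s ^ (α * (k : ℝ)) / (α ^ k * (Nat.factorial k : ℝ) ^ α))) := by
          ring
      _ ≤ _ := by gcongr
  have hsummable := (summable_natCast_mul_leRoy hα (by positivity : 0 < 2 * τ)).mul_left
    (α * (τ / 2)⁻¹)
  exact hasDerivAt_tsum_of_isPreconnected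
    (g := fun (k : ℕ) (s : ℝ) => s ^ (α * (k : ℝ)) / (α ^ k * (Nat.factorial k : ℝ) ^ α))
    (g' := fun (k : ℕ) (s : ℝ) =>
      α * k * s ^ (α * (k : ℝ) - 1) / (α ^ k * (Nat.factorial k : ℝ) ^ α))
    hsummable isOpen_Ioo isPreconnected_Ioo
    (fun k s hs => (Real.hasDerivAt_rpow_const
      (Or.inl (by linarith [hs.1] : 0 < s).ne')).div_const _)
    hbound hmem (summable_leRoy hα hτ) hmem

/-- Each term of the differentiated series, integrated against the Hadamard kernel,
is a multiple of the preceding term of the original series. -/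
lemma natCast_succ_leRoy_integral {α t : ℝ} (hα : 0 < α) (ht : 0 < t) (G : ℝ) (k : ℕ) :
    α * ((k + 1 : ℕ) : ℝ) / (α ^ (k + 1) * (Nat.factorial (k + 1) : ℝ) ^ α) *
        (t ^ (α * ((k + 1 : ℕ) : ℝ)) * ((α * ((k + 1 : ℕ) : ℝ)) ^ (α - 1) * G)) =
      G * (α ^ (α - 1) * t ^ α) *
        (t ^ (α * (k : ℝ)) / (α ^ k * (Nat.factorial k : ℝ) ^ α)) := by
  have hk : (0 : ℝ) < ((k + 1 : ℕ) : ℝ) := by positivity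
  have ht' : t ^ (α * ((k + 1 : ℕ) : ℝ)) = t ^ (α * (k : ℝ)) * t ^ α := by
    rw [← Real.rpow_add ht]
    push_cast
    ring_nf
  rw [ht', Nat.factorial_succ, Nat.cast_mul, Real.mul_rpow hk.le (by positivity),
    Real.mul_rpow hα.le hk.le, Real.rpow_sub_one hk.ne', pow_succ]
  field_simp

/-- For `α ∈ (0,1)` and `t > 0`, the Le Roy-type function
`f(s) = E_{α;1,1}(s^α/α) = ∑ s^(αk) / (α^k (k!)^α)` satisfies the Caputo–Hadamard
fractional equation `t^(-α) (t d/dt)^α f = α^(α-1) f`: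
`(1/Γ(1-α)) ∫_0^t (log(t/τ))^(-α) f'(τ) dτ = α^(α-1) t^α f(t)`. -/
theorem leRoy_caputo_hadamard_equation (α t : ℝ) (hα : α ∈ Set.Ioo (0:ℝ) 1)
    (ht : 0 < t) :
    (1 / Real.Gamma (1 - α)) *
        ∫ τ in (0:ℝ)..t, Real.log (t / τ) ^ (-α) *
          deriv (fun s : ℝ =>
            ∑' k : ℕ, s ^ (α * (k : ℝ)) / (α ^ k * (Nat.factorial k : ℝ) ^ α)) τ
      = α ^ (α - 1) * t ^ α *
        ∑' k : ℕ, t ^ (α * (k : ℝ)) / (α ^ k * (Nat.factorial k : ℝ) ^ α) := by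
  obtain ⟨hα0, hα1⟩ := hα
  set c : ℕ → ℝ := fun k => α * k / (α ^ k * (Nat.factorial k : ℝ) ^ α)
  have hc (k : ℕ) : 0 ≤ c k := by positivity
  set F : ℕ → ℝ → ℝ := fun k τ => c k * (Real.log (t / τ) ^ (-α) * τ ^ (α * (k : ℝ) - 1))
  have hF0 : F 0 = 0 := by
    ext τ
    simp [F, c]
  have hFint (k : ℕ) : Integrable (F k) (volume.restrict (Ioc 0 t)) := by
    rcases k with _ | k
    · rw [hF0]
      exact integrable_zero _ _ _
    · exact (integrableOn_log_rpow_mul_rpow hα1 (by positivity) ht).const_mul _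
  have hFnonneg (k : ℕ) (τ : ℝ) (hτ : τ ∈ Ioc 0 t) : 0 ≤ F k τ :=
    mul_nonneg (hc k) (mul_nonneg
      (Real.rpow_nonneg (Real.log_nonneg ((one_le_div hτ.1).2 hτ.2)) _)
      (Real.rpow_nonneg hτ.1.le _))
  have hsucc (k : ℕ) : ∫ τ in Ioc 0 t, F (k + 1) τ =
      Real.Gamma (1 - α) * (α ^ (α - 1) * t ^ α) *
        (t ^ (α * (k : ℝ)) / (α ^ k * (Nat.factorial k : ℝ) ^ α)) := by
    rw [← natCast_succ_leRoy_integral hα0 ht, integral_const_mul,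
      integral_log_rpow_mul_rpow hα1 (by positivity) ht]
  have hsum : HasSum (fun k => ∫ τ in Ioc 0 t, F k τ)
      (Real.Gamma (1 - α) * (α ^ (α - 1) * t ^ α) *
        ∑' k : ℕ, t ^ (α * (k : ℝ)) / (α ^ k * (Nat.factorial k : ℝ) ^ α)) := by
    rw [← hasSum_nat_add_iff' 1]
    simpa only [hsucc, Finset.sum_range_one, hF0, Pi.zero_apply, integral_zero, sub_zero]
      using (summable_leRoy hα0 ht).hasSum.mul_left _
  have hnorm (k : ℕ) : ∫ τ in Ioc 0 t, ‖F k τ‖ = ∫ τ in Ioc 0 t, F k τ :=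
    setIntegral_congr_fun measurableSet_Ioc fun τ hτ => Real.norm_of_nonneg (hFnonneg k τ hτ)
  have hint := hasSum_integral_of_summable_integral_norm hFint
    (by simpa only [hnorm] using hsum.summable)
  have hderiv : ∫ τ in Ioc 0 t, Real.log (t / τ) ^ (-α) * deriv (fun s : ℝ =>
        ∑' k : ℕ, s ^ (α * (k : ℝ)) / (α ^ k * (Nat.factorial k : ℝ) ^ α)) τ =
      ∫ τ in Ioc 0 t, ∑' k, F k τ := by
    refine setIntegral_congr_fun measurableSet_Ioc fun τ hτ => ?_
    simp only [(hasDerivAt_leRoy hα0 hτ.1).deriv]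
    rw [← tsum_mul_left]
    refine tsum_congr fun k => ?_
    simp only [F, c]
    ring
  have hΓ : Real.Gamma (1 - α) ≠ 0 := (Real.Gamma_pos_of_pos (by linarith)).ne'
  rw [intervalIntegral.integral_of_le ht.le, hderiv, hint.unique hsum]
  field_simp
end

section
/- Let n ≥ 2 be an integer, let r be an integer with 1 ≤ r ≤ n−1, let λ be a real number, and let f(t) = ∑_{k=0}^∞ λ^k t^k / (k!)^n (a series converging for every real t). Then for every real t, applying to f first the (n−r)-fold iterate δ^{n−r} of the operator δ: g ↦ (t ↦ t·g′(t)), and then the Laguerre-type operator (d/dt) t (d/dt) t ⋯ (d/dt) containing r differentiations d/dt alternating with r−1 multiplications by t, yields λ f(t). That is, f(t) = E_{n;1,1}(λt) is an eigenfunction with eigenvalue λ of the operator (d/dt t d/dt ⋯ d/dt) ∘ (t d/dt)^{n−r}, which is the integer-order (β = n) case of the mixed Laguerre–Hadamard operator. -/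
/-- A real power series converging everywhere may be differentiated term by term. -/
theorem hasDerivAt_tsum_mul_pow {a : ℕ → ℝ} (ha : ∀ x : ℝ, Summable fun k => a k * x ^ k)
    (x : ℝ) :
    HasDerivAt (fun y => ∑' k, a k * y ^ k) (∑' k : ℕ, a k * ((k : ℝ) * x ^ (k - 1))) x := by
  have hR : 1 ≤ |x| + 1 := by linarith [abs_nonneg x]
  refine hasDerivAt_tsum_of_isPreconnected (u := fun k => |a k * (2 * (|x| + 1)) ^ k|)
    (t := Metric.ball 0 (|x| + 1)) (y₀ := 0) (ha _).abs Metric.isOpen_ball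
    (convex_ball _ _).isPreconnected (fun k y _ => (hasDerivAt_pow k y).const_mul (a k)) ?_ ?_
    (ha 0) ?_
  · intro k y hy
    have hy' : |y| ≤ |x| + 1 := by
      simpa using (Metric.mem_ball.1 hy).le
    have hk : (k : ℝ) ≤ 2 ^ k := by exact_mod_cast Nat.lt_two_pow_self.le
    rw [Real.norm_eq_abs, abs_mul, abs_mul, abs_mul, abs_pow, abs_pow, Nat.abs_cast,
      abs_of_nonneg (by positivity : 0 ≤ 2 * (|x| + 1)), mul_pow]
    gcongr
    calc |y| ^ (k - 1) ≤ (|x| + 1) ^ (k - 1) := by gcongr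
      _ ≤ (|x| + 1) ^ k := pow_le_pow_right₀ hR (Nat.sub_le k 1)
  · exact Metric.mem_ball_self (by positivity)
  · simp

/-- Multiplying the coefficients of an everywhere convergent power series by the index preserves
convergence. -/
theorem summable_natCast_mul_mul_pow {a : ℕ → ℝ} (ha : ∀ x : ℝ, Summable fun k => a k * x ^ k)
    (x : ℝ) : Summable fun k : ℕ => (k : ℝ) * a k * x ^ k := by
  refine Summable.of_norm_bounded (ha (2 * x)).abs fun k => ?_
  have hk : (k : ℝ) ≤ 2 ^ k := by exact_mod_cast Nat.lt_two_pow_self.le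
  calc ‖(k : ℝ) * a k * x ^ k‖ = k * |a k * x ^ k| := by
        rw [Real.norm_eq_abs, mul_assoc, abs_mul, Nat.abs_cast]
    _ ≤ 2 ^ k * |a k * x ^ k| := by gcongr
    _ = |a k * (2 * x) ^ k| := by
        rw [mul_pow, mul_left_comm, abs_mul (2 ^ k), abs_of_nonneg (by positivity : (0 : ℝ) ≤ 2 ^ k)]

/-- The operator `g ↦ x g'` multiplies the `k`-th coefficient of a power series by `k`. -/
theorem mul_deriv_tsum_mul_pow {a : ℕ → ℝ} (ha : ∀ x : ℝ, Summable fun k => a k * x ^ k) :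
    (fun x : ℝ => x * deriv (fun y => ∑' k, a k * y ^ k) x) =
      fun x => ∑' k : ℕ, (k : ℝ) * a k * x ^ k := by
  funext x
  rw [(hasDerivAt_tsum_mul_pow ha x).deriv, ← tsum_mul_left]
  refine tsum_congr fun k => ?_
  cases k with
  | zero => simp
  | succ k => rw [Nat.add_sub_cancel, pow_succ]; ring

/-- Iterates of the operator `g ↦ x g'` on an everywhere convergent power series. -/
theorem iterate_mul_deriv_tsum_mul_pow (m : ℕ) {a : ℕ → ℝ}
    (ha : ∀ x : ℝ, Summable fun k => a k * x ^ k) :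
    (∀ x : ℝ, Summable fun k : ℕ => (k : ℝ) ^ m * a k * x ^ k) ∧
    (fun g : ℝ → ℝ => fun x : ℝ => x * deriv g x)^[m] (fun x => ∑' k, a k * x ^ k) =
      fun x => ∑' k : ℕ, (k : ℝ) ^ m * a k * x ^ k := by
  induction m with
  | zero => simpa using ha
  | succ m ih =>
    obtain ⟨hs, he⟩ := ih
    refine ⟨fun x => ?_, ?_⟩
    · simpa only [pow_succ', mul_assoc] using summable_natCast_mul_mul_pow hs x
    · rw [Function.iterate_succ_apply', he]
      simpa only [pow_succ', mul_assoc] using mul_deriv_tsum_mul_pow hs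

/-- The Le Roy-type series converges everywhere. -/
theorem summable_pow_div_factorial_pow_mul_pow {n : ℕ} (hn : n ≠ 0) (lam x : ℝ) :
    Summable fun k : ℕ => lam ^ k / (Nat.factorial k : ℝ) ^ n * x ^ k := by
  refine Summable.of_norm_bounded (Real.summable_pow_div_factorial (lam * x)).abs fun k => ?_
  have h1 : (1 : ℝ) ≤ Nat.factorial k := by
    exact_mod_cast Nat.one_le_iff_ne_zero.2 k.factorial_ne_zero
  rw [Real.norm_eq_abs, div_mul_eq_mul_div, ← mul_pow, abs_div, abs_div, abs_pow (_ : ℝ) n,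
    Nat.abs_cast]
  gcongr
  exact le_self_pow₀ h1 hn


/-- For integers `n ≥ 2` and `1 ≤ r ≤ n - 1`, and real `λ`, the function
`f(t) = E_{n;1,1}(λt) = ∑ λ^k t^k / (k!)^n` is an eigenfunction with eigenvalue `λ`
of the mixed Laguerre–Hadamard operator
`(d/dt t d/dt ⋯ d/dt) ∘ (t d/dt)^(n-r)` (`r` differentiations in the Laguerre part),
where `δ : g ↦ (t ↦ t·g'(t))` and the Laguerre part is `deriv ∘ δ^[r-1]`. -/
theorem leRoy_laguerre_hadamard_eigenfunction (n r : ℕ) (hn : 2 ≤ n)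
    (hr1 : 1 ≤ r) (hr2 : r ≤ n - 1) (lam : ℝ) :
    ∀ t : ℝ,
      deriv ((fun g : ℝ → ℝ => fun x : ℝ => x * deriv g x)^[r - 1]
        ((fun g : ℝ → ℝ => fun x : ℝ => x * deriv g x)^[n - r]
          (fun x : ℝ => ∑' k : ℕ, lam ^ k * x ^ k / (Nat.factorial k : ℝ) ^ n))) t
      = lam * ∑' k : ℕ, lam ^ k * t ^ k / (Nat.factorial k : ℝ) ^ n := by
  intro t
  have ha := summable_pow_div_factorial_pow_mul_pow (n := n) (by omega) lam
  obtain ⟨hs, he⟩ := iterate_mul_deriv_tsum_mul_pow (n - 1) ha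
  simp only [mul_div_right_comm]
  rw [← Function.iterate_add_apply, show r - 1 + (n - r) = n - 1 by omega, he,
    (hasDerivAt_tsum_mul_pow hs t).deriv, ← tsum_mul_left]
  obtain ⟨m, rfl⟩ : ∃ m, n = m + 1 := ⟨n - 1, by omega⟩
  have hterm : ∀ k : ℕ, ((k + 1 : ℕ) : ℝ) ^ (m + 1 - 1) *
      (lam ^ (k + 1) / (Nat.factorial (k + 1) : ℝ) ^ (m + 1)) *
        (((k + 1 : ℕ) : ℝ) * t ^ (k + 1 - 1)) =
      lam * (lam ^ k / (Nat.factorial k : ℝ) ^ (m + 1) * t ^ k) := by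
    intro k
    have hk : ((k + 1 : ℕ) : ℝ) ≠ 0 := by positivity
    have hf : (Nat.factorial k : ℝ) ≠ 0 := by positivity
    rw [Nat.factorial_succ, Nat.cast_mul, mul_pow, Nat.add_sub_cancel, Nat.add_sub_cancel]
    field_simp
    ring
  rw [← tsum_congr hterm]
  refine (Function.Injective.tsum_eq (add_left_injective 1) fun k hk => ?_).symm
  cases k with
  | zero => simp at hk
  | succ k => exact ⟨k, rfl⟩
end
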